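/- arXiv:2410.06300 — 3 statements merged into one kernel-verified Lean document; each statement's English description precedes it below -/
import Mathlib

section
/- Let n ≥ 1, let i ∈ [n] = {1,…,n}, and let A ⊆ [n] \ {i} with |A| = a. Then Σ_{S ⊆ [n]\{i}} (|S|! · (n−|S|−1)! / n!) · (−1)^{|S∩A|} = ((a+1) mod 2)/(a+1); that is, the sum equals 1/(a+1) when a is even and equals 0 when a is odd. -/
open Finset

/-- Integer inner product `⟨f,y⟩ = Σ_j f_j y_j` of two points of `{0,1}^n`. -/
def ip {n : ℕ} (f y : Fin n → Fin 2) : ℕ := ∑ j : Fin n, (f j : ℕ) * (y j : ℕ)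

/-- Hybrid point: coordinates from `xstar` on `S`, from `x` off `S`. -/
def hybrid {n : ℕ} (xstar x : Fin n → Fin 2) (S : Finset (Fin n)) : Fin n → Fin 2 :=
  fun j => if j ∈ S then xstar j else x j

/-- Shapley kernel weight `|S|!·(n−|S|−1)!/n!`. -/
noncomputable def shapWeight (n : ℕ) (S : Finset (Fin n)) : ℝ :=
  ((Nat.factorial S.card * Nat.factorial (n - S.card - 1) : ℕ) : ℝ) / (Nat.factorial n : ℝ)

/-- Value function: average prediction over the background dataset `D`
when fixing the coordinates of the explained instance `xstar` on `S`. -/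
noncomputable def valueFn {n : ℕ} (h : (Fin n → Fin 2) → ℝ) (D : List (Fin n → Fin 2))
    (xstar : Fin n → Fin 2) (S : Finset (Fin n)) : ℝ :=
  (1 / (D.length : ℝ)) * (D.map (fun x => h (hybrid xstar x S))).sum

/-- SHAP value of feature `i` for predictor `h`, background dataset `D`, instance `xstar`. -/
noncomputable def shapValue {n : ℕ} (h : (Fin n → Fin 2) → ℝ) (D : List (Fin n → Fin 2))
    (xstar : Fin n → Fin 2) (i : Fin n) : ℝ :=
  ∑ S ∈ (Finset.univ.erase i).powerset,
    shapWeight n S * (valueFn h D xstar (insert i S) - valueFn h D xstar S)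

/-- The Euler beta integral at natural number exponents. -/
theorem integral_pow_mul_one_sub_pow (k l : ℕ) :
    ∫ x in (0 : ℝ)..1, x ^ k * (1 - x) ^ l
      = (k.factorial * l.factorial : ℝ) / (k + l + 1).factorial := by
  induction l generalizing k with
  | zero =>
    simp only [pow_zero, mul_one, integral_pow, Nat.factorial_zero, Nat.cast_one, add_zero,
      Nat.factorial_succ]
    push_cast
    field_simp
    simp
  | succ l ih =>
    have hsub : ∀ x : ℝ, x ^ k * (1 - x) ^ (l + 1)
        = x ^ k * (1 - x) ^ l - x ^ (k + 1) * (1 - x) ^ l := fun x => by ring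
    simp_rw [hsub]
    rw [intervalIntegral.integral_sub
      (Continuous.intervalIntegrable (by fun_prop) _ _)
      (Continuous.intervalIntegrable (by fun_prop) _ _), ih, ih,
      show k + 1 + l + 1 = (k + l + 1) + 1 by ring, show k + (l + 1) + 1 = (k + l + 1) + 1 by ring,
      Nat.factorial_succ (k + l + 1), Nat.factorial_succ k, Nat.factorial_succ l]
    push_cast
    field_simp
    ring

theorem integral_one_sub_two_mul_pow (a : ℕ) :
    ∫ x in (0 : ℝ)..1, (1 - 2 * x) ^ a = (((a + 1) % 2 : ℕ) : ℝ) / ((a : ℝ) + 1) := by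
  rw [intervalIntegral.integral_comp_sub_mul (fun y : ℝ => y ^ a) two_ne_zero, integral_pow]
  norm_num
  rcases Nat.even_or_odd a with h | h
  · rw [h.add_one.neg_one_pow, Nat.odd_iff.mp h.add_one]
    norm_num
    ring
  · rw [h.add_one.neg_one_pow, Nat.even_iff.mp h.add_one]
    norm_num

/-- Expansion over subsets of `U` of a product whose factors are `1 - 2 * x` on `A` and `1`
elsewhere. -/
theorem sum_powerset_pow_mul_one_sub_pow_mul_neg_one_pow {ι R : Type*} [DecidableEq ι]
    [CommRing R] {A U : Finset ι} (hA : A ⊆ U) (x : R) :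
    ∑ S ∈ U.powerset, x ^ #S * (1 - x) ^ (#U - #S) * (-1) ^ #(S ∩ A)
      = (1 - 2 * x) ^ #A := by
  have hprod : ∏ j ∈ U, (x * (if j ∈ A then -1 else 1) + (1 - x)) = (1 - 2 * x) ^ #A := by
    have hfac : ∀ j, x * (if j ∈ A then -1 else 1) + (1 - x) = if j ∈ A then 1 - 2 * x else 1 := by
      intro j
      split_ifs <;> ring
    simp_rw [hfac]
    rw [prod_ite_mem, inter_eq_right.mpr hA, prod_const]
  rw [← hprod, prod_add]
  refine sum_congr rfl fun S hS => ?_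
  rw [prod_mul_distrib, prod_ite_mem, prod_const, prod_const, prod_const,
    card_sdiff_of_subset (mem_powerset.mp hS)]
  ring

/-- the key combinatorial identity. For `A ⊆ [n]\{i}` with `|A| = a`,
`Σ_{S ⊆ [n]\{i}} (|S|!(n−|S|−1)!/n!)·(−1)^{|S∩A|} = ((a+1) mod 2)/(a+1)`. -/
theorem shapley_kernel_parity_sum (n : ℕ) (hn : 1 ≤ n) (i : Fin n)
    (A : Finset (Fin n)) (hA : A ⊆ Finset.univ.erase i) (a : ℕ) (ha : A.card = a) :
    ∑ S ∈ (Finset.univ.erase i).powerset,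
      shapWeight n S * (-1 : ℝ) ^ (S ∩ A).card
      = (((a + 1) % 2 : ℕ) : ℝ) / ((a : ℝ) + 1) := by
  have hcard : #(univ.erase i) = n - 1 := by simp
  rw [← integral_one_sub_two_mul_pow a, ← ha]
  simp_rw [← sum_powerset_pow_mul_one_sub_pow_mul_neg_one_pow hA]
  rw [intervalIntegral.integral_finsetSum
    fun S _ => Continuous.intervalIntegrable (by fun_prop) _ _]
  refine sum_congr rfl fun S hS => ?_
  have hS' : #S ≤ n - 1 := hcard ▸ card_le_card (mem_powerset.mp hS)
  rw [intervalIntegral.integral_mul_const, integral_pow_mul_one_sub_pow, hcard, shapWeight,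
    show #S + (n - 1 - #S) + 1 = n by omega, show n - 1 - #S = n - #S - 1 by omega]
  push_cast
  rfl
end

section
/- (Theorem 2 of the paper, exactness of the closed-form SHAP expression.) Let n ≥ 1 and let h : {0,1}^n → ℝ be given by a Fourier expansion h(x) = Σ_{f ∈ F} ĥ(f) · (−1)^{⟨f,x⟩} for a finite set F ⊆ {0,1}^n of frequencies with real amplitudes ĥ(f). Let 𝒟 be a nonempty finite multiset of points in {0,1}^n, let x* ∈ {0,1}^n, and let i ∈ [n]. Then the SHAP value of feature i for h with respect to 𝒟 and x* satisfies φ_i^h = −(2/|𝒟|) Σ_{f ∈ F} ĥ(f) · f_i · Σ_{x ∈ 𝒟} 1[x_i ≠ x*_i] · (−1)^{⟨f,x⟩} · ((|A_{f,x}|+1) mod 2)/(|A_{f,x}|+1), where A_{f,x} = {j ∈ [n] : x_j ≠ x*_j, j ≠ i, f_j = 1}. -/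
open Finset

/-- The Shapley weight of a coalition of size `s` among `m` other players. -/
noncomputable def coalitionWeight (m s : ℕ) : ℝ :=
  ((s.factorial * (m - s).factorial : ℕ) : ℝ) / ((m + 1).factorial : ℝ)

theorem coalitionWeight_add_succ {m s : ℕ} (hs : s ≤ m) :
    coalitionWeight (m + 1) s + coalitionWeight (m + 1) (s + 1) = coalitionWeight m s := by
  obtain ⟨k, rfl⟩ := Nat.exists_eq_add_of_le hs
  have h1 : s + k + 1 - s = k + 1 := by omega
  have h2 : s + k + 1 - (s + 1) = k := by omega
  have h3 : s + k - s = k := by omega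
  have h4 : ((s + k + 1).factorial : ℝ) ≠ 0 := by positivity
  have h5 : (s : ℝ) + k + 1 + 1 ≠ 0 := by positivity
  unfold coalitionWeight
  rw [h1, h2, h3, Nat.factorial_succ (s + k + 1), Nat.factorial_succ s, Nat.factorial_succ k]
  push_cast
  field_simp
  ring

theorem choose_mul_coalitionWeight {m s : ℕ} (hs : s ≤ m) :
    (m.choose s : ℝ) * coalitionWeight m s = 1 / ((m : ℝ) + 1) := by
  have h1 : ((m.choose s * s.factorial * (m - s).factorial : ℕ) : ℝ) = m.factorial := by
    rw [Nat.choose_mul_factorial_mul_factorial hs]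
  have h2 : (m.factorial : ℝ) ≠ 0 := by positivity
  have h3 : (m : ℝ) + 1 ≠ 0 := by positivity
  unfold coalitionWeight
  rw [Nat.factorial_succ]
  push_cast at h1 ⊢
  rw [← mul_div_assoc, ← mul_assoc, h1]
  field_simp

theorem sum_range_succ_neg_one_pow (a : ℕ) :
    ∑ k ∈ range (a + 1), (-1 : ℝ) ^ k = (((a + 1) % 2 : ℕ) : ℝ) := by
  rw [neg_one_geom_sum]
  rcases Nat.even_or_odd (a + 1) with h | h
  · simp [h, Nat.even_iff.mp h]
  · simp [Nat.not_even_iff_odd.mpr h, Nat.odd_iff.mp h]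

theorem sum_powerset_coalitionWeight_mul_neg_one_pow {α : Type*} (A : Finset α) :
    ∑ S ∈ A.powerset, coalitionWeight A.card S.card * (-1 : ℝ) ^ S.card
      = (((A.card + 1) % 2 : ℕ) : ℝ) / ((A.card : ℝ) + 1) := by
  rw [sum_powerset_apply_card (fun k => coalitionWeight A.card k * (-1 : ℝ) ^ k),
    ← sum_range_succ_neg_one_pow, sum_div]
  refine sum_congr rfl fun k hk => ?_
  rw [nsmul_eq_mul, ← mul_assoc,
    choose_mul_coalitionWeight (Nat.lt_succ_iff.mp (mem_range.mp hk))]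
  ring

/-- Players with trivial factor do not influence the Shapley-weighted sum of products. -/
theorem sum_powerset_union_coalitionWeight_mul_prod {α : Type*} [DecidableEq α]
    (A B : Finset α) (hAB : Disjoint A B) (ε : α → ℝ) (hε : ∀ j ∈ B, ε j = 1) :
    ∑ S ∈ (B ∪ A).powerset, coalitionWeight (B ∪ A).card S.card * ∏ j ∈ S, ε j
      = ∑ S ∈ A.powerset, coalitionWeight A.card S.card * ∏ j ∈ S, ε j := by
  induction B using Finset.induction_on with
  | empty => simp
  | insert b B hb ih =>
    rw [disjoint_insert_right] at hAB
    have hbU : b ∉ B ∪ A := by simp [hb, hAB.1]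
    rw [← ih hAB.2 fun j hj => hε j (mem_insert_of_mem hj), insert_union,
      sum_powerset_insert hbU, ← sum_add_distrib, card_insert_of_notMem hbU]
    refine sum_congr rfl fun S hS => ?_
    have hSU := mem_powerset.mp hS
    have hbS : b ∉ S := fun h => hbU (hSU h)
    rw [card_insert_of_notMem hbS, prod_insert hbS, hε b (mem_insert_self b B), one_mul,
      ← add_mul, coalitionWeight_add_succ (card_le_card hSU)]

/-- The sign acquired by the character of frequency `f` when coordinate `j` of `x` is replaced
by that of `xstar`. -/
noncomputable def flipSign {n : ℕ} (f xstar x : Fin n → Fin 2) (j : Fin n) : ℝ :=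
  if x j ≠ xstar j ∧ f j = 1 then -1 else 1

theorem neg_one_pow_ip_hybrid {n : ℕ} (f xstar x : Fin n → Fin 2) (S : Finset (Fin n)) :
    (-1 : ℝ) ^ ip f (hybrid xstar x S)
      = (-1 : ℝ) ^ ip f x * ∏ j ∈ S, flipSign f xstar x j := by
  have hS : ∏ j ∈ S, flipSign f xstar x j
      = ∏ j, if j ∈ S then flipSign f xstar x j else 1 := by
    rw [prod_ite_mem, univ_inter]
  rw [hS, ip, ip, ← prod_pow_eq_pow_sum, ← prod_pow_eq_pow_sum, ← prod_mul_distrib]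
  refine prod_congr rfl fun j _ => ?_
  unfold hybrid flipSign
  by_cases hj : j ∈ S
  · simp only [hj, if_true]
    generalize f j = a
    generalize x j = b
    generalize xstar j = c
    fin_cases a <;> fin_cases b <;> fin_cases c <;> simp
  · simp [hj]

theorem shapWeight_eq_coalitionWeight {n : ℕ} (i : Fin n) (S : Finset (Fin n)) :
    shapWeight n S = coalitionWeight (univ.erase i).card S.card := by
  have hn : 0 < n := i.pos
  have h1 : (univ.erase i : Finset (Fin n)).card = n - 1 := by simp
  have h2 : n - S.card - 1 = n - 1 - S.card := by omega
  rw [shapWeight, coalitionWeight, h1, h2, Nat.sub_add_cancel hn]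

theorem sum_shapWeight_mul_prod_flipSign {n : ℕ} (f xstar x : Fin n → Fin 2) (i : Fin n) :
    ∑ S ∈ (univ.erase i).powerset, shapWeight n S * ∏ j ∈ S, flipSign f xstar x j
      = (((univ.filter (fun j => x j ≠ xstar j ∧ j ≠ i ∧ f j = 1)).card + 1) % 2 : ℕ) /
        (((univ.filter (fun j => x j ≠ xstar j ∧ j ≠ i ∧ f j = 1)).card : ℝ) + 1) := by
  set A := univ.filter (fun j => x j ≠ xstar j ∧ j ≠ i ∧ f j = 1) with hA
  have hAi : A ⊆ univ.erase i := fun j hj => by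
    simp only [hA, mem_filter] at hj
    simp [hj.2.2.1]
  have hB : ∀ j ∈ univ.erase i \ A, flipSign f xstar x j = 1 := fun j hj => by
    simp only [hA, mem_sdiff, mem_erase, mem_filter, mem_univ, true_and, and_true] at hj
    exact if_neg fun h => hj.2 ⟨h.1, hj.1, h.2⟩
  have key := sum_powerset_union_coalitionWeight_mul_prod A (univ.erase i \ A)
    disjoint_sdiff (flipSign f xstar x) hB
  rw [sdiff_union_of_subset hAi] at key
  simp only [shapWeight_eq_coalitionWeight i]
  rw [key, ← sum_powerset_coalitionWeight_mul_neg_one_pow]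
  refine sum_congr rfl fun S hS => ?_
  congr 1
  refine prod_eq_pow_card fun j hj => ?_
  have hjA := mem_powerset.mp hS hj
  simp only [hA, mem_filter] at hjA
  exact if_pos ⟨hjA.2.1, hjA.2.2.2⟩

theorem sum_shapWeight_mul_neg_one_pow_ip_sub {n : ℕ} (f xstar x : Fin n → Fin 2)
    (i : Fin n) :
    ∑ S ∈ (univ.erase i).powerset, shapWeight n S *
        ((-1 : ℝ) ^ ip f (hybrid xstar x (insert i S)) - (-1 : ℝ) ^ ip f (hybrid xstar x S))
      = -2 * ((f i : ℕ) : ℝ) * ((if x i ≠ xstar i then (1 : ℝ) else 0) * (-1 : ℝ) ^ ip f x *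
        ((((univ.filter (fun j => x j ≠ xstar j ∧ j ≠ i ∧ f j = 1)).card + 1) % 2 : ℕ) /
        (((univ.filter (fun j => x j ≠ xstar j ∧ j ≠ i ∧ f j = 1)).card : ℝ) + 1))) := by
  have hi : flipSign f xstar x i - 1
      = -2 * ((f i : ℕ) : ℝ) * (if x i ≠ xstar i then (1 : ℝ) else 0) := by
    unfold flipSign
    generalize f i = a
    by_cases hx : x i = xstar i <;> fin_cases a <;> simp [hx] <;> norm_num
  rw [← sum_shapWeight_mul_prod_flipSign, mul_sum, mul_sum]
  refine sum_congr rfl fun S hS => ?_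
  have hiS : i ∉ S := fun h => notMem_erase i univ (mem_powerset.mp hS h)
  rw [neg_one_pow_ip_hybrid, neg_one_pow_ip_hybrid, prod_insert hiS]
  linear_combination (shapWeight n S * (-1 : ℝ) ^ ip f x *
    ∏ j ∈ S, flipSign f xstar x j) * hi

theorem shapValue_eq_sum_map {n : ℕ} (h : (Fin n → Fin 2) → ℝ) (D : List (Fin n → Fin 2))
    (xstar : Fin n → Fin 2) (i : Fin n) :
    shapValue h D xstar i = (1 / (D.length : ℝ)) * (D.map fun x =>
      ∑ S ∈ (univ.erase i).powerset, shapWeight n S *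
        (h (hybrid xstar x (insert i S)) - h (hybrid xstar x S))).sum := by
  unfold shapValue valueFn
  generalize 1 / (D.length : ℝ) = c
  induction D with
  | nil => simp
  | cons x D ih =>
    simp only [List.map_cons, List.sum_cons]
    rw [mul_add, ← ih, mul_sum, ← sum_add_distrib]
    exact sum_congr rfl fun S _ => by ring

/-- Theorem 2 of the paper: exact closed-form SHAP values for a
function given by a finite Fourier expansion `h(x) = Σ_{f∈F} ĥ(f)·(−1)^{⟨f,x⟩}`. -/
theorem shap_fourier_closed_form (n : ℕ) (hn : 1 ≤ n)
    (F : Finset (Fin n → Fin 2)) (hhat : (Fin n → Fin 2) → ℝ)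
    (h : (Fin n → Fin 2) → ℝ)
    (hexp : ∀ x, h x = ∑ f ∈ F, hhat f * (-1 : ℝ) ^ ip f x)
    (D : List (Fin n → Fin 2)) (hD : D ≠ []) (xstar : Fin n → Fin 2) (i : Fin n) :
    shapValue h D xstar i
      = -(2 / (D.length : ℝ)) *
        ∑ f ∈ F, hhat f * ((f i : ℕ) : ℝ) *
          (D.map (fun x =>
            (if x i ≠ xstar i then (1 : ℝ) else 0) * (-1 : ℝ) ^ ip f x *
              (((((Finset.univ.filter
                    (fun j => x j ≠ xstar j ∧ j ≠ i ∧ f j = 1)).card + 1) % 2 : ℕ) : ℝ) /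
                (((Finset.univ.filter
                    (fun j => x j ≠ xstar j ∧ j ≠ i ∧ f j = 1)).card : ℝ) + 1)))).sum := by
  rw [shapValue_eq_sum_map]
  have hx : ∀ x, ∑ S ∈ (univ.erase i).powerset, shapWeight n S *
        (h (hybrid xstar x (insert i S)) - h (hybrid xstar x S))
      = ∑ f ∈ F, hhat f * ∑ S ∈ (univ.erase i).powerset, shapWeight n S *
        ((-1 : ℝ) ^ ip f (hybrid xstar x (insert i S))
          - (-1 : ℝ) ^ ip f (hybrid xstar x S)) := fun x => by
    simp only [hexp, ← sum_sub_distrib, mul_sum]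
    rw [sum_comm]
    exact sum_congr rfl fun f _ => sum_congr rfl fun S _ => by ring
  simp only [hx, sum_shapWeight_mul_neg_one_pow_ip_sub]
  rw [← Multiset.sum_coe, ← Multiset.map_coe, Multiset.sum_map_sum, mul_sum, mul_sum]
  refine sum_congr rfl fun f _ => ?_
  rw [Multiset.sum_map_mul_left, Multiset.sum_map_mul_left, Multiset.map_coe, Multiset.sum_coe]
  ring
end

section
/- Let n ≥ 1, f ∈ {0,1}^n with f_i = 0 for some i ∈ [n], let Ψ_f(x) = (−1)^{⟨f,x⟩}, let 𝒟 be a nonempty finite multiset of points in {0,1}^n, and let x* ∈ {0,1}^n. Then the SHAP value of feature i for Ψ_f is zero: φ_i^{Ψ_f} = 0. Consequently, for any h : {0,1}^n → ℝ with Fourier expansion h = Σ_{f ∈ F} ĥ(f) Ψ_f, only frequencies f with f_i = 1 contribute to φ_i^h. -/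
open Finset

theorem ip_hybrid_insert {n : ℕ} (f xstar x : Fin n → Fin 2) (S : Finset (Fin n)) {i : Fin n}
    (hf : f i = 0) : ip f (hybrid xstar x (insert i S)) = ip f (hybrid xstar x S) := by
  refine Finset.sum_congr rfl fun j _ => ?_
  by_cases hj : j = i
  · simp [hj, hf]
  · simp [hybrid, hj]

theorem shapValue_eq_zero_of_insert {n : ℕ} {h : (Fin n → Fin 2) → ℝ} (D : List (Fin n → Fin 2))
    {xstar : Fin n → Fin 2} {i : Fin n}
    (hh : ∀ x S, h (hybrid xstar x (insert i S)) = h (hybrid xstar x S)) :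
    shapValue h D xstar i = 0 := by
  simp [shapValue, valueFn, hh]

theorem valueFn_sum {n : ℕ} {ι : Type*} (F : Finset ι) (c : ι → ℝ)
    (g : ι → (Fin n → Fin 2) → ℝ) (D : List (Fin n → Fin 2)) (xstar : Fin n → Fin 2)
    (S : Finset (Fin n)) :
    valueFn (fun x => ∑ a ∈ F, c a * g a x) D xstar S
      = ∑ a ∈ F, c a * valueFn (g a) D xstar S := by
  have key : (D.map fun x => ∑ a ∈ F, c a * g a (hybrid xstar x S)).sum
      = ∑ a ∈ F, c a * (D.map fun x => g a (hybrid xstar x S)).sum := by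
    induction D with
    | nil => simp
    | cons x D ih => simp [ih, mul_add, Finset.sum_add_distrib]
  simp only [valueFn, key, Finset.mul_sum]
  exact Finset.sum_congr rfl fun a _ => by ring

theorem shapValue_sum {n : ℕ} {ι : Type*} (F : Finset ι) (c : ι → ℝ)
    (g : ι → (Fin n → Fin 2) → ℝ) (D : List (Fin n → Fin 2)) (xstar : Fin n → Fin 2)
    (i : Fin n) :
    shapValue (fun x => ∑ a ∈ F, c a * g a x) D xstar i
      = ∑ a ∈ F, c a * shapValue (g a) D xstar i := by
  simp only [shapValue, valueFn_sum, ← Finset.sum_sub_distrib, Finset.mul_sum]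
  rw [Finset.sum_comm]
  exact Finset.sum_congr rfl fun a _ => Finset.sum_congr rfl fun S _ => by ring

/-- if `f_i = 0` then the SHAP value of feature `i` for the basis
function `Ψ_f` vanishes; consequently, for `h = Σ_{f∈F} ĥ(f)Ψ_f` only the
frequencies with `f_i = 1` contribute to `φ_i^h`. -/
theorem shap_basis_zero_coordinate (n : ℕ) (hn : 1 ≤ n)
    (D : List (Fin n → Fin 2)) (hD : D ≠ []) (xstar : Fin n → Fin 2) (i : Fin n) :
    (∀ f : Fin n → Fin 2, f i = 0 →
      shapValue (fun x => (-1 : ℝ) ^ ip f x) D xstar i = 0) ∧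
    (∀ (F : Finset (Fin n → Fin 2)) (hhat : (Fin n → Fin 2) → ℝ)
        (h : (Fin n → Fin 2) → ℝ),
      (∀ x, h x = ∑ f ∈ F, hhat f * (-1 : ℝ) ^ ip f x) →
      shapValue h D xstar i
        = ∑ f ∈ F.filter (fun f => f i = 1),
            hhat f * shapValue (fun x => (-1 : ℝ) ^ ip f x) D xstar i) := by
  have vanish : ∀ f : Fin n → Fin 2, f i = 0 →
      shapValue (fun x => (-1 : ℝ) ^ ip f x) D xstar i = 0 := fun f hf =>
    shapValue_eq_zero_of_insert D fun x S => by rw [ip_hybrid_insert f xstar x S hf]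
  refine ⟨vanish, fun F hhat h hexp => ?_⟩
  rw [funext hexp, shapValue_sum F hhat fun f x => (-1 : ℝ) ^ ip f x]
  symm
  refine Finset.sum_filter_of_ne fun f _ hne => ?_
  by_contra hf
  exact hne (by rw [vanish f (by omega), mul_zero])
end
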